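/- Let 𝒞 be a set of continuous cost functions that is closed under composition and consistent for weighted resource graph games. Then one of the following holds: (1) for each c ∈ 𝒞 with c : ℝ_{≥0}^m → ℝ^m for some m ∈ ℕ there exist a symmetric matrix A ∈ ℝ^{m×m} and a vector b ∈ ℝ^m such that c(x) = A x + b for all x ∈ ℝ_{≥0}^m; or (2) there exists φ ∈ ℝ such that for each c ∈ 𝒞 with c : ℝ_{≥0}^m → ℝ^m there exist a, b ∈ ℝ^m such that c_r(x) = a_r exp(φ x_r) + b_r for all r ∈ {1,…,m} and all x ∈ ℝ_{≥0}^m. -/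

import Mathlib

open Finset NNReal

/-- The indicator vector of a set `S` of resources, as a vector of nonnegative reals. -/
def nindicVec {m : ℕ} (S : Finset (Fin m)) : Fin m → NNReal :=
  fun r => if r ∈ S then 1 else 0

/-- The load vector induced by weights `w` and a profile `y` of `0/1`-vectors. -/
def wloadVec {n m : ℕ} (w : Fin n → NNReal) (y : Fin n → Fin m → ℕ) : Fin m → NNReal :=
  fun r => ∑ i, w i * (y i r : NNReal)

/-- The private cost of player `i` in the weighted resource graph game. -/
noncomputable def wPlayerCost {n m : ℕ} (c : (Fin m → NNReal) → Fin m → ℝ)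
    (w : Fin n → NNReal) (y : Fin n → Fin m → ℕ) (i : Fin n) : ℝ :=
  ∑ r, ((w i : ℝ) * (y i r : ℝ)) * c (wloadVec w y) r

/-- `Y` is a valid system of strategy sets: each `Y i` is a nonempty
finite set of `0/1`-vectors. -/
def IsStrategySets {n m : ℕ} (Y : Fin n → Finset (Fin m → ℕ)) : Prop :=
  (∀ i, (Y i).Nonempty) ∧ ∀ i, ∀ v ∈ Y i, ∀ r, v r ≤ 1

/-- `y` is a pure Nash equilibrium of the weighted resource graph game with
weights `w`, strategy sets `Y`, and cost function `c`. -/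
def IsWPNE {n m : ℕ} (c : (Fin m → NNReal) → Fin m → ℝ) (w : Fin n → NNReal)
    (Y : Fin n → Finset (Fin m → ℕ)) (y : Fin n → Fin m → ℕ) : Prop :=
  (∀ i, y i ∈ Y i) ∧
    ∀ i, ∀ y' ∈ Y i,
      wPlayerCost c w y i ≤ wPlayerCost c w (Function.update y i y') i

/-- The composition `c ⊕ c'` of two cost functions. -/
def woplus {m m' : ℕ} (c : (Fin m → NNReal) → Fin m → ℝ)
    (c' : (Fin m' → NNReal) → Fin m' → ℝ) :
    (Fin (m + m') → NNReal) → Fin (m + m') → ℝ :=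
  fun x => Fin.addCases (motive := fun _ => ℝ)
    (fun i => c (fun j => x (Fin.castAdd m' j)) i)
    (fun i => c' (fun j => x (Fin.natAdd m j)) i)

/-- A set of cost functions on the nonnegative orthant, one set for each number
`m` of resources. -/
abbrev WCostFamily := (m : ℕ) → Set ((Fin m → NNReal) → Fin m → ℝ)

/-- `𝒞` is closed under composition. -/
def WClosedUnderComposition (𝒞 : WCostFamily) : Prop :=
  ∀ m m' : ℕ, ∀ c ∈ 𝒞 m, ∀ c' ∈ 𝒞 m', woplus c c' ∈ 𝒞 (m + m')

/-- `𝒞` is consistent for weighted resource graph games: every weighted resource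
graph game whose cost function belongs to `𝒞` has a pure Nash equilibrium. -/
def WConsistent (𝒞 : WCostFamily) : Prop :=
  ∀ m : ℕ, ∀ c ∈ 𝒞 m, ∀ n : ℕ, ∀ w : Fin n → NNReal, (∀ i, 0 < w i) →
    ∀ Y : Fin n → Finset (Fin m → ℕ), IsStrategySets Y →
      ∃ y, IsWPNE c w Y y

/-- A continuous additive real function on the nonnegative reals is linear. -/
lemma nnreal_additive_linear {H : ℝ≥0 → ℝ} (hc : Continuous H)
    (hadd : ∀ s t, H (s + t) = H s + H t) (t : ℝ≥0) : H t = t * H 1 := by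
  have h0 : H 0 = 0 := by
    have := hadd 0 0
    rw [add_zero] at this
    linarith
  let L : ℝ →+ ℝ := AddMonoidHom.mk' (fun x => H x.toNNReal - H (-x).toNNReal) (by
    intro x y
    have key : (x + y).toNNReal + ((-x).toNNReal + (-y).toNNReal)
        = (-(x + y)).toNNReal + (x.toNNReal + y.toNNReal) := by
      apply NNReal.eq
      have e (u : ℝ) : max u 0 = max (-u) 0 + u := by
        rcases le_total u 0 with h | h <;> simp [h]
      simp only [NNReal.coe_add, Real.coe_toNNReal']
      rw [e (x + y), e x, e y]
      ring
    have := congrArg H key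
    simp only [hadd] at this
    linarith)
  have hL : Continuous L := by
    change Continuous fun x : ℝ => H x.toNNReal - H (-x).toNNReal
    fun_prop
  have := map_real_smul L hL (t : ℝ) 1
  have hneg (u : ℝ≥0) : (-(u : ℝ)).toNNReal = 0 := Real.toNNReal_of_nonpos (by simp)
  have h1 : (-1 : ℝ).toNNReal = 0 := Real.toNNReal_of_nonpos (by simp)
  simpa [L, h0, hneg, h1] using this

/-- A continuous real function on the nonnegative reals which turns sums into products
is an exponential function. -/
lemma nnreal_multiplicative_exp {M : ℝ≥0 → ℝ} (hc : Continuous M) (h0 : M 0 = 1)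
    (hmul : ∀ s t, M (s + t) = M s * M t) : ∃ φ : ℝ, ∀ t : ℝ≥0, M t = Real.exp (φ * t) := by
  have half (t : ℝ≥0) : M t = M (t / 2) * M (t / 2) := by rw [← hmul, add_halves]
  have hne (t : ℝ≥0) : M t ≠ 0 := by
    intro ht
    have hz (n : ℕ) : M (t / 2 ^ n) = 0 := by
      induction n with
      | zero => simpa using ht
      | succ n ih =>
        rw [half, div_div, ← pow_succ] at ih
        exact mul_self_eq_zero.mp ih
    have hlim : Filter.Tendsto (fun n : ℕ => t / 2 ^ n) Filter.atTop (nhds 0) := by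
      have : Filter.Tendsto (fun n : ℕ => t * (1 / 2 : ℝ≥0) ^ n) Filter.atTop (nhds (t * 0)) :=
        (NNReal.tendsto_pow_atTop_nhds_zero_of_lt_one
          (by rw [← NNReal.coe_lt_coe]; norm_num)).const_mul t
      simpa [div_eq_mul_inv] using this
    have h1 := (hc.tendsto 0).comp hlim
    have h2 : (M ∘ fun n : ℕ => t / 2 ^ n) = fun _ => 0 := funext hz
    rw [h2, h0] at h1
    exact zero_ne_one (tendsto_nhds_unique tendsto_const_nhds h1)
  have hpos (t : ℝ≥0) : 0 < M t := by
    rw [half]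
    exact mul_self_pos.mpr (hne _)
  refine ⟨Real.log (M 1), fun t => ?_⟩
  have := nnreal_additive_linear (H := fun t => Real.log (M t))
    (hc.log hne) (fun s t => by rw [hmul, Real.log_mul (hne _) (hne _)]) t
  rw [mul_comm, ← this, Real.exp_log (hpos t)]

/-- Solutions of the functional equation stating that all increment functions of `k` are
proportional. -/
lemma affine_or_exp_of_increments {k : ℝ≥0 → ℝ} (hc : Continuous k) (hk : ∃ t, k t ≠ k 0)
    (h : ∀ d d' u v, (k (u + d) - k u) * (k (v + d') - k v)
      = (k (v + d) - k v) * (k (u + d') - k u)) :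
    ∃ α : ℝ, α ≠ 0 ∧ ((∀ t, k t = k 0 + α * t) ∨
      ∃ φ : ℝ, φ ≠ 0 ∧ ∀ t, k t = k 0 + α * (Real.exp (φ * t) - 1)) := by
  obtain ⟨d₀, hd₀⟩ := hk
  have hD : k d₀ - k 0 ≠ 0 := sub_ne_zero.mpr hd₀
  set H : ℝ≥0 → ℝ := fun t => k t - k 0 with hH
  have hHc : Continuous H := by fun_prop
  set ψ : ℝ≥0 → ℝ := fun t => (H (t + d₀) - H t) / H d₀ with hψ
  have hadd (t d) : H (t + d) = H t + ψ t * H d := by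
    have := h d d₀ t 0
    simp only [zero_add] at this
    simp only [hψ, hH]
    field_simp
    linear_combination this
  set κ : ℝ := (ψ d₀ - 1) / H d₀ with hκ
  have hψκ (t) : ψ t = 1 + κ * H t := by
    have h1 := hadd t d₀
    have h2 := hadd d₀ t
    rw [add_comm d₀ t, h1] at h2
    have h3 : H d₀ ≠ 0 := hD
    rw [hκ]
    field_simp
    linear_combination h2
  have hadd' (s t) : H (s + t) = H s + H t + κ * H s * H t := by
    rw [hadd, hψκ]; ring
  have hH0 : H 0 = 0 := sub_self _
  by_cases hκ0 : κ = 0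
  · have hlin := nnreal_additive_linear hHc (fun s t => by rw [hadd', hκ0]; ring)
    refine ⟨H 1, fun h1 => hD ?_, Or.inl fun t => ?_⟩
    · have := hlin d₀
      rwa [h1, mul_zero] at this
    · have := hlin t
      simp only [hH] at this ⊢
      linarith
  · obtain ⟨φ, hφ⟩ := nnreal_multiplicative_exp (M := fun t => 1 + κ * H t) (by fun_prop)
      (by simp [hH0]) (fun s t => by simp only [hadd']; ring)
    have hform (t) : k t = k 0 + 1 / κ * (Real.exp (φ * t) - 1) := by
      rw [← hφ t]
      simp only [hH]
      field_simp
      ring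
    refine ⟨1 / κ, by simpa using hκ0, Or.inr ⟨φ, ?_, hform⟩⟩
    rintro rfl
    apply hd₀
    simpa using hform d₀

/-- Local proportionality of increments away from zero extends to global proportionality
away from zero. -/
lemma increments_of_close_increments {k : ℝ≥0 → ℝ} {u₀ : ℝ≥0} (hu₀ : 0 < u₀)
    (h : ∀ d d' u v, d ≤ d' → d' ≤ d + u₀ → u₀ ≤ u → u₀ ≤ v →
      (k (u + d) - k u) * (k (v + d') - k v) = (k (v + d) - k v) * (k (u + d') - k u))
    (d d' u v : ℝ≥0) (hu : u₀ ≤ u) (hv : u₀ ≤ v) :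
    (k (u + d) - k u) * (k (v + d') - k v) = (k (v + d) - k v) * (k (u + d') - k u) := by
  by_cases hconst : ∀ u, u₀ ≤ u → ∀ d, k (u + d) = k u
  · simp [hconst u hu, hconst v hv]
  have hdense (p q : ℝ≥0) (hpq : p < q) :
      ∃ e, p ≤ e ∧ e ≤ q ∧ ∃ u, u₀ ≤ u ∧ k (u + e) - k u ≠ 0 := by
    by_contra! hcon
    refine hconst fun u hu d => ?_
    have hper (s : ℝ≥0) (hs : u₀ ≤ s) (e : ℝ≥0) (h1 : p ≤ e) (h2 : e ≤ q) : k (s + e) = k s :=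
      sub_eq_zero.mp (hcon e h1 h2 s hs)
    have hsmall (s : ℝ≥0) (hs : u₀ ≤ s) (δ : ℝ≥0) (hδ : p + δ ≤ q) : k (s + δ) = k s := by
      rw [← hper (s + δ) (hs.trans le_self_add) p le_rfl hpq.le, add_assoc, add_comm δ p]
      exact hper s hs (p + δ) le_self_add hδ
    obtain ⟨η, hη⟩ := exists_add_of_le hpq.le
    have hη0 : 0 < η := by
      rw [hη] at hpq
      exact pos_of_lt_add_right hpq
    obtain ⟨n, hn⟩ := exists_nat_gt (d / η)
    have hn0 : (0 : ℝ≥0) < n := lt_of_le_of_lt zero_le hn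
    have hδ : d / n ≤ η := by
      rw [div_lt_iff₀ hη0] at hn
      rw [div_le_iff₀ hn0, mul_comm]
      exact hn.le
    have hsteps (j : ℕ) : k (u + j * (d / n)) = k u := by
      induction j with
      | zero => simp
      | succ j ih =>
        rw [← ih]
        have := hsmall (u + j * (d / n)) (hu.trans le_self_add) (d / n)
          (by rw [hη]; gcongr)
        rw [← this]
        congr 1
        push_cast
        ring
    have := hsteps n
    rwa [mul_div_cancel₀ _ hn0.ne'] at this
  have hchain (n : ℕ) : ∀ d d' : ℝ≥0, d ≤ d' → d' ≤ d + n * (u₀ / 2) → ∀ u v, u₀ ≤ u → u₀ ≤ v →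
      (k (u + d) - k u) * (k (v + d') - k v) = (k (v + d) - k v) * (k (u + d') - k u) := by
    induction n with
    | zero =>
      intro d d' h1 h2 u v hu hv
      exact h d d' u v h1 (h2.trans (by simp)) hu hv
    | succ n ih =>
      intro d d' h1 h2 u v hu hv
      by_cases hd : d' ≤ d + u₀
      · exact h d d' u v h1 hd hu hv
      push Not at hd
      obtain ⟨p, hp⟩ := exists_add_of_le hd.le
      obtain ⟨e, he1, he2, w, hw, hne⟩ := hdense (d + p) (d + p + u₀ / 2)
        (lt_add_of_pos_right _ (half_pos hu₀))
      have hd' : d' = d + p + u₀ / 2 + u₀ / 2 := by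
        rw [hp, add_assoc (d + p), add_halves]; ring
      have hde : d ≤ e := le_self_add.trans he1
      have hed' : e ≤ d' := he2.trans (by rw [hd']; exact le_self_add)
      have A := ih d e hde (he2.trans (by
        rw [hd'] at h2
        push_cast at h2
        rw [add_mul, one_mul, ← add_assoc] at h2
        exact le_of_add_le_add_right h2))
      have A1 := A u w hu hw
      have A2 := A v w hv hw
      have hb : d' ≤ e + u₀ := by
        rw [hd', add_assoc, add_halves]; gcongr
      have B1 := h e d' u w hed' hb hu hw
      have B2 := h e d' v w hed' hb hv hw
      apply mul_right_cancel₀ (mul_ne_zero hne hne)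
      generalize k (u + d) - k u = a1 at *
      generalize k (v + d) - k v = a2 at *
      generalize k (w + d) - k w = a3 at *
      generalize k (u + e) - k u = b1 at *
      generalize k (v + e) - k v = b2 at *
      generalize k (w + e) - k w = b3 at *
      generalize k (u + d') - k u = c1 at *
      generalize k (v + d') - k v = c2 at *
      generalize k (w + d') - k w = c3 at *
      have e1 : a1 * b3 * (c2 * b3) = a3 * b1 * (b2 * c3) := by rw [A1, B2]; ring
      have e2 : a2 * b3 * (c1 * b3) = a3 * b2 * (b1 * c3) := by rw [A2, B1]; ring
      linear_combination e1 - e2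
  have hall (d d' : ℝ≥0) (hdd : d ≤ d') (u v : ℝ≥0) (hu : u₀ ≤ u) (hv : u₀ ≤ v) :
      (k (u + d) - k u) * (k (v + d') - k v) = (k (v + d) - k v) * (k (u + d') - k u) := by
    obtain ⟨n, hn⟩ := exists_nat_gt (d' / (u₀ / 2))
    rw [div_lt_iff₀ (half_pos hu₀)] at hn
    exact hchain n d d' hdd (hn.le.trans le_add_self) u v hu hv
  rcases le_total d d' with hdd | hdd
  · exact hall d d' hdd u v hu hv
  · linear_combination -hall d' d hdd u v hu hv

/-- A nonconstant continuous function satisfying the collinearity condition arising from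
two-player games is affine or exponential. -/
lemma affine_or_exp_of_collinear {k : ℝ≥0 → ℝ} (hc : Continuous k) (hk : ∃ t, k t ≠ k 0)
    (h : ∀ w₁ w₂ : ℝ≥0, 0 < w₁ → 0 < w₂ → ∀ t t' : ℝ≥0,
      (k (t + w₁ + w₂) - k (t + w₁)) * (k (t' + w₁ + w₂) - k (t' + w₂))
        = (k (t' + w₁ + w₂) - k (t' + w₁)) * (k (t + w₁ + w₂) - k (t + w₂))) :
    ∃ α : ℝ, α ≠ 0 ∧ ((∀ t, k t = k 0 + α * t) ∨
      ∃ φ : ℝ, φ ≠ 0 ∧ ∀ t, k t = k 0 + α * (Real.exp (φ * t) - 1)) := by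
  refine affine_or_exp_of_increments hc hk fun d d' u v => ?_
  have haway (ε : ℝ≥0) (hε : 0 < ε) :
      (k (u + ε + d) - k (u + ε)) * (k (v + ε + d') - k (v + ε))
        = (k (v + ε + d) - k (v + ε)) * (k (u + ε + d') - k (u + ε)) := by
    refine increments_of_close_increments hε ?_ d d' _ _ le_add_self le_add_self
    intro d d' u v hdd hdε hu hv
    obtain ⟨a, rfl⟩ := exists_add_of_le hdd
    have ha : a ≤ ε := le_of_add_le_add_left hdε
    obtain ⟨t, rfl⟩ := exists_add_of_le (ha.trans hu)
    obtain ⟨t', rfl⟩ := exists_add_of_le (ha.trans hv)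
    rcases eq_or_ne d 0 with rfl | hd
    · simp
    rcases eq_or_ne a 0 with rfl | ha0
    · simp; ring
    have := h (d + a) a (by positivity) (by positivity) t t'
    have e (t : ℝ≥0) : t + (d + a) + a = a + t + (d + a) := by ring
    have e' (t : ℝ≥0) : t + (d + a) = a + t + d := by ring
    have e'' (t : ℝ≥0) : t + a = a + t := by ring
    rw [e t, e t', e' t, e' t', e'' t, e'' t'] at this
    linear_combination -this
  have := Continuous.ext_on (dense_compl_singleton (0 : ℝ≥0))
    (f := fun ε => (k (u + ε + d) - k (u + ε)) * (k (v + ε + d') - k (v + ε)))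
    (g := fun ε => (k (v + ε + d) - k (v + ε)) * (k (u + ε + d') - k (u + ε)))
    (by fun_prop) (by fun_prop) (fun ε hε => haway ε (pos_iff_ne_zero.mpr hε))
  simpa using congrFun this 0

/-- A function whose increments are related as those of an injective function `z` is
an affine function of `z`. -/
lemma affine_in_of_increments {h z : ℝ≥0 → ℝ} (hh : Continuous h) (hz : Continuous z)
    (hinj : Function.Injective z)
    (hrel : ∀ w₁ w₂ : ℝ≥0, 0 < w₁ → 0 < w₂ → ∀ t : ℝ≥0,
      (z (t + w₁ + w₂) - z (t + w₂)) * (h (t + w₁ + w₂) - h (t + w₁))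
        = (z (t + w₁ + w₂) - z (t + w₁)) * (h (t + w₁ + w₂) - h (t + w₂))) :
    ∃ A : ℝ, ∀ t, h t = h 0 + A * (z t - z 0) := by
  have hrel' (b₁ b₂ c : ℝ≥0) (h1 : b₁ < c) (h2 : b₂ < c) (h12 : c ≤ b₁ + b₂) :
      (z c - z b₂) * (h c - h b₁) = (z c - z b₁) * (h c - h b₂) := by
    obtain ⟨w₂, rfl⟩ := exists_add_of_le h1.le
    obtain ⟨t, rfl⟩ := exists_add_of_le (le_of_add_le_add_left h12)
    obtain ⟨w₁, hw₁⟩ := exists_add_of_le h2.le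
    have e : b₁ = t + w₁ := by
      apply add_right_cancel (b := w₂)
      rw [hw₁]; ring
    subst e
    have p2 : 0 < w₂ := pos_of_lt_add_right h1
    have p1 : 0 < w₁ := by
      rw [hw₁] at h2
      exact pos_of_lt_add_right h2
    have := hrel w₁ w₂ p1 p2 t
    rwa [add_comm w₂ t]
  have hlocal (c : ℝ≥0) (hc : 0 < c) : ∃ σ : ℝ, ∀ b, b ≤ c → h c - h b = σ * (z c - z b) := by
    have hhalf : c / 2 < c := NNReal.half_lt_self hc.ne'
    have hzne (b : ℝ≥0) (hb : b < c) : z c - z b ≠ 0 :=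
      sub_ne_zero.mpr fun e => hb.ne' (hinj e)
    have upper (b : ℝ≥0) (hb : b < c) (hb' : c / 2 ≤ b) :
        h c - h b = (h c - h (c / 2)) / (z c - z (c / 2)) * (z c - z b) := by
      have := hrel' b (c / 2) c hb hhalf (by
        calc c = c / 2 + c / 2 := (add_halves c).symm
          _ ≤ b + c / 2 := by gcongr)
      have hne := hzne _ hhalf
      field_simp
      linarith
    have pos (b : ℝ≥0) (hb : b < c) (hb0 : 0 < b) :
        h c - h b = (h c - h (c / 2)) / (z c - z (c / 2)) * (z c - z b) := by
      rcases le_total (c / 2) b with hb' | hb'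
      · exact upper b hb hb'
      obtain ⟨b', hbb⟩ := exists_add_of_le hb.le
      have hb'c : b' < c := by
        rw [hbb]; exact lt_add_of_pos_left _ hb0
      have hb'2 : c / 2 ≤ b' := by
        have : c / 2 + c / 2 ≤ c / 2 + b' := by
          rw [add_halves]
          calc c = b + b' := hbb
            _ ≤ c / 2 + b' := by gcongr
        exact le_of_add_le_add_left this
      have h1 := upper b' hb'c hb'2
      have h2 := hrel' b b' c hb hb'c hbb.le
      apply mul_left_cancel₀ (hzne b' hb'c)
      rw [h2, h1]
      ring
    refine ⟨(h c - h (c / 2)) / (z c - z (c / 2)), fun b hb => ?_⟩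
    rcases hb.eq_or_lt with rfl | hb
    · simp
    rcases eq_or_ne b 0 with rfl | hb0
    · set σ := (h c - h (c / 2)) / (z c - z (c / 2))
      have hmem : (0 : ℝ≥0) ∈ closure (Set.Ioo 0 c) := by
        rw [closure_Ioo hc.ne]
        exact ⟨le_rfl, hc.le⟩
      have hclosed : IsClosed {b | h c - h b = σ * (z c - z b)} :=
        isClosed_eq (by fun_prop) (by fun_prop)
      exact hclosed.closure_subset_iff.mpr (fun b hb => pos b hb.2 hb.1) hmem
    · exact pos b hb (pos_iff_ne_zero.mpr hb0)
  obtain ⟨σ, hσ⟩ := hlocal 1 one_pos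
  have hz1 : z 1 - z 0 ≠ 0 := sub_ne_zero.mpr fun e => one_ne_zero (hinj e)
  refine ⟨σ, fun t => ?_⟩
  rcases le_total t 1 with ht | ht
  · linear_combination hσ 0 zero_le_one - hσ t ht
  · obtain ⟨τ, hτ⟩ := hlocal t (one_pos.trans_le ht)
    have h1 := hτ 1 ht
    have h0 := hτ 0 zero_le
    have h2 := hσ 0 zero_le_one
    have : τ = σ := by
      apply mul_right_cancel₀ hz1
      linear_combination h2 - h0 + h1
    rw [← this]
    linear_combination h0

/-- The load vector when two players with weights `w₁`, `w₂` use `S`, `T` on top of the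
base load `x`. -/
def pairLoad {m : ℕ} (x : Fin m → ℝ≥0) (w₁ w₂ : ℝ≥0) (S T : Fin m → ℕ) : Fin m → ℝ≥0 :=
  fun r => x r + w₁ * S r + w₂ * T r

/-- The cost per unit of weight of a player using `S` under load `l`. -/
def unitCost {m : ℕ} (c : (Fin m → ℝ≥0) → Fin m → ℝ) (S : Fin m → ℕ) (l : Fin m → ℝ≥0) : ℝ :=
  ∑ r, (S r : ℝ) * c l r

/-- The two-player two-strategy games arising from `𝒞` in which matching the opponent changes
the unit cost of the first player by `F` and that of the second player by `G`. -/
def Realizes (𝒞 : WCostFamily) (w₁ w₂ : ℝ≥0) (F G : ℝ) : Prop :=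
  ∃ m : ℕ, ∃ c ∈ 𝒞 m, ∃ (x : Fin m → ℝ≥0) (S T : Bool → Fin m → ℕ),
    (∀ i r, S i r ≤ 1) ∧ (∀ i r, T i r ≤ 1) ∧
    (∀ i, unitCost c (S i) (pairLoad x w₁ w₂ (S i) (T i))
      - unitCost c (S !i) (pairLoad x w₁ w₂ (S !i) (T i)) = F) ∧
    (∀ i, unitCost c (T i) (pairLoad x w₁ w₂ (S i) (T i))
      - unitCost c (T !i) (pairLoad x w₁ w₂ (S i) (T !i)) = G)

lemma unitCost_append {m m' : ℕ} (c : (Fin m → ℝ≥0) → Fin m → ℝ)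
    (c' : (Fin m' → ℝ≥0) → Fin m' → ℝ) (x : Fin m → ℝ≥0) (x' : Fin m' → ℝ≥0) (w₁ w₂ : ℝ≥0)
    (U S T : Fin m → ℕ) (U' S' T' : Fin m' → ℕ) :
    unitCost (woplus c c') (Fin.append U U')
        (pairLoad (Fin.append x x') w₁ w₂ (Fin.append S S') (Fin.append T T'))
      = unitCost c U (pairLoad x w₁ w₂ S T) + unitCost c' U' (pairLoad x' w₁ w₂ S' T') := by
  have h1 : (fun j => pairLoad (Fin.append x x') w₁ w₂ (Fin.append S S') (Fin.append T T')
      (Fin.castAdd m' j)) = pairLoad x w₁ w₂ S T := by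
    funext j; simp [pairLoad]
  have h2 : (fun j => pairLoad (Fin.append x x') w₁ w₂ (Fin.append S S') (Fin.append T T')
      (Fin.natAdd m j)) = pairLoad x' w₁ w₂ S' T' := by
    funext j; simp [pairLoad]
  simp [unitCost, woplus, Fin.sum_univ_add, h1, h2]

lemma append_le_one {m m' : ℕ} {S : Fin m → ℕ} {S' : Fin m' → ℕ} (h : ∀ r, S r ≤ 1)
    (h' : ∀ r, S' r ≤ 1) (r : Fin (m + m')) : Fin.append S S' r ≤ 1 := by
  induction r using Fin.addCases with
  | left r => simpa using h r
  | right r => simpa using h' r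

lemma Realizes.add {𝒞 : WCostFamily} (hcomp : WClosedUnderComposition 𝒞) {w₁ w₂ : ℝ≥0}
    {F G F' G' : ℝ} (h : Realizes 𝒞 w₁ w₂ F G) (h' : Realizes 𝒞 w₁ w₂ F' G') :
    Realizes 𝒞 w₁ w₂ (F + F') (G + G') := by
  obtain ⟨m, c, hc, x, S, T, hS, hT, hF, hG⟩ := h
  obtain ⟨m', c', hc', x', S', T', hS', hT', hF', hG'⟩ := h'
  refine ⟨m + m', woplus c c', hcomp m m' c hc c' hc', Fin.append x x',
    fun i => Fin.append (S i) (S' i), fun i => Fin.append (T i) (T' i),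
    fun i => append_le_one (hS i) (hS' i), fun i => append_le_one (hT i) (hT' i),
    fun i => ?_, fun i => ?_⟩
  · simp only [unitCost_append]
    linear_combination hF i + hF' i
  · simp only [unitCost_append]
    linear_combination hG i + hG' i

lemma Realizes.neg {𝒞 : WCostFamily} {w₁ w₂ : ℝ≥0}
    {F G : ℝ} (h : Realizes 𝒞 w₁ w₂ F G) : Realizes 𝒞 w₁ w₂ (-F) (-G) := by
  obtain ⟨m, c, hc, x, S, T, hS, hT, hF, hG⟩ := h
  refine ⟨m, c, hc, x, S, fun i => T !i, hS, fun i => hT !i, fun i => ?_, fun i => ?_⟩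
  · have := hF !i
    simp only [Bool.not_not] at this
    linear_combination -this
  · have := hG i
    simp only [Bool.not_not]
    linear_combination -this

lemma Realizes.natCast_mul {𝒞 : WCostFamily} (hcomp : WClosedUnderComposition 𝒞) {w₁ w₂ : ℝ≥0}
    {F G : ℝ} (h : Realizes 𝒞 w₁ w₂ F G) (n : ℕ) : Realizes 𝒞 w₁ w₂ (n * F) (n * G) := by
  induction n with
  | zero => simpa using h.add hcomp h.neg
  | succ n ih =>
    have := ih.add hcomp h
    convert this using 1 <;> (push_cast; ring)

lemma Realizes.intCast_mul {𝒞 : WCostFamily} (hcomp : WClosedUnderComposition 𝒞) {w₁ w₂ : ℝ≥0}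
    {F G : ℝ} (h : Realizes 𝒞 w₁ w₂ F G) (n : ℤ) : Realizes 𝒞 w₁ w₂ (n * F) (n * G) := by
  obtain ⟨k, rfl | rfl⟩ := n.eq_nat_or_neg
  · exact_mod_cast h.natCast_mul hcomp k
  · simpa using (h.natCast_mul hcomp k).neg

/-- A two-player game on top of a base load has an equilibrium, the base load being generated
by additional players with a single strategy. -/
lemma exists_equilibrium_with_base_load {𝒞 : WCostFamily} (hcons : WConsistent 𝒞) {m : ℕ}
    {c : (Fin m → ℝ≥0) → Fin m → ℝ} (hc : c ∈ 𝒞 m) (x : Fin m → ℝ≥0) {w₁ w₂ : ℝ≥0}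
    (hw₁ : 0 < w₁) (hw₂ : 0 < w₂) (S T : Bool → Fin m → ℕ) (hS : ∀ i r, S i r ≤ 1)
    (hT : ∀ i r, T i r ≤ 1) :
    ∃ i j, (∀ i', unitCost c (S i) (pairLoad x w₁ w₂ (S i) (T j))
        ≤ unitCost c (S i') (pairLoad x w₁ w₂ (S i') (T j))) ∧
      ∀ j', unitCost c (T j) (pairLoad x w₁ w₂ (S i) (T j))
        ≤ unitCost c (T j') (pairLoad x w₁ w₂ (S i) (T j')) := by
  classical
  let w : Fin (m + 1 + 1) → ℝ≥0 :=
    Fin.cons w₁ (Fin.cons w₂ fun r => if x r = 0 then 1 else x r)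
  let b : Fin m → Fin m → ℕ := fun r => if x r = 0 then 0 else Pi.single r 1
  let Y : Fin (m + 1 + 1) → Finset (Fin m → ℕ) :=
    Fin.cons (univ.image S) (Fin.cons (univ.image T) fun r => {b r})
  have hb (r s : Fin m) : b r s ≤ 1 := by
    by_cases h : x r = 0
    · simp [b, h]
    · by_cases hs : s = r
      · subst hs; simp [b, h]
      · simp [b, h, hs]
  obtain ⟨y, hyY, hy⟩ := hcons m c hc (m + 1 + 1) w (by
      refine Fin.cases hw₁ (Fin.cases hw₂ fun r => ?_)
      simp only [w, Fin.cons_succ]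
      split_ifs with h
      · exact one_pos
      · exact pos_iff_ne_zero.mpr h) Y (by
      refine ⟨Fin.cases (univ_nonempty.image S) (Fin.cases (univ_nonempty.image T)
        fun r => singleton_nonempty (b r)), Fin.cases ?_ (Fin.cases ?_ fun r => ?_)⟩
      · intro v hv
        obtain ⟨i, -, rfl⟩ := mem_image.mp hv
        exact hS i
      · intro v hv
        obtain ⟨i, -, rfl⟩ := mem_image.mp hv
        exact hT i
      · intro v hv
        have : v = b r := mem_singleton.mp hv
        subst this
        exact hb r)
  have hy0 := hyY 0
  have hy1 := hyY 1
  obtain ⟨i, -, hi⟩ := mem_image.mp (show y 0 ∈ univ.image S from hy0)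
  obtain ⟨j, -, hj⟩ := mem_image.mp (show y 1 ∈ univ.image T from hy1)
  have hyr (r : Fin m) : y r.succ.succ = b r :=
    mem_singleton.mp (show y r.succ.succ ∈ ({b r} : Finset _) from hyY r.succ.succ)
  have hload (U V : Fin m → ℕ) : wloadVec w (Fin.cons U (Fin.cons V b))
      = pairLoad x w₁ w₂ U V := by
    funext s
    simp only [wloadVec, Fin.sum_univ_succ, pairLoad, w, Fin.cons_zero, Fin.cons_succ]
    have : ∑ r, (if x r = 0 then 1 else x r) * (b r s : ℝ≥0) = x s := by
      rw [Finset.sum_eq_single s]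
      · by_cases h : x s = 0 <;> simp [b, h]
      · intro r _ hr
        by_cases h : x r = 0 <;> simp [b, h, hr.symm]
      · simp
    rw [this]
    ring
  have hyeq : y = Fin.cons (S i) (Fin.cons (T j) b) := by
    funext a
    refine Fin.cases hi.symm (Fin.cases hj.symm fun r => hyr r) a
  have hupd0 (U : Fin m → ℕ) : Function.update y 0 U = Fin.cons U (Fin.cons (T j) b) := by
    rw [hyeq, Fin.update_cons_zero]
  have hupd1 (V : Fin m → ℕ) : Function.update y 1 V = Fin.cons (S i) (Fin.cons V b) := by
    rw [hyeq, show (1 : Fin (m + 1 + 1)) = Fin.succ 0 from rfl, ← Fin.cons_update,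
      Fin.update_cons_zero]
  have hcost0 (U V : Fin m → ℕ) : wPlayerCost c w (Fin.cons U (Fin.cons V b)) 0
      = w₁ * unitCost c U (pairLoad x w₁ w₂ U V) := by
    simp only [wPlayerCost, hload, unitCost, Finset.mul_sum, w, Fin.cons_zero, mul_assoc]
  have hcost1 (U V : Fin m → ℕ) : wPlayerCost c w (Fin.cons U (Fin.cons V b)) 1
      = w₂ * unitCost c V (pairLoad x w₁ w₂ U V) := by
    simp only [wPlayerCost, hload, unitCost, Finset.mul_sum, w,
      show (1 : Fin (m + 1 + 1)) = Fin.succ 0 from rfl, Fin.cons_succ, Fin.cons_zero, mul_assoc]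
  refine ⟨i, j, fun i' => ?_, fun j' => ?_⟩
  · have := hy 0 (S i') (mem_image_of_mem S (mem_univ i'))
    rw [hupd0, hyeq, hcost0, hcost0] at this
    exact le_of_mul_le_mul_left this (NNReal.coe_pos.mpr hw₁)
  · have := hy 1 (T j') (mem_image_of_mem T (mem_univ j'))
    rw [hupd1, hyeq, hcost1, hcost1] at this
    exact le_of_mul_le_mul_left this (NNReal.coe_pos.mpr hw₂)

lemma Realizes.not_opposite {𝒞 : WCostFamily} (hcons : WConsistent 𝒞) {w₁ w₂ : ℝ≥0}
    (hw₁ : 0 < w₁) (hw₂ : 0 < w₂) {F G : ℝ} (h : Realizes 𝒞 w₁ w₂ F G) (hF : 0 < F)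
    (hG : G < 0) : False := by
  obtain ⟨m, c, hc, x, S, T, hS, hT, hF', hG'⟩ := h
  obtain ⟨i, j, h1, h2⟩ := exists_equilibrium_with_base_load hcons hc x hw₁ hw₂ S T hS hT
  by_cases hij : i = j
  · subst hij
    have := h1 !i
    linarith [hF' i]
  · have hj : j = !i := by cases i <;> cases j <;> simp_all
    subst hj
    have := h2 i
    linarith [hG' i]

/-- A pair of real numbers generating, together with another one, no integer combination
in the fourth quadrant is collinear to it. -/
lemma collinear_of_no_integer_combination {F G F' G' : ℝ}
    (h : ∀ p q : ℤ, 0 < p * F + q * F' → p * G + q * G' < 0 → False) : F * G' = F' * G := by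
  by_contra hne
  have hD : F * G' - F' * G ≠ 0 := sub_ne_zero.mpr hne
  set N : ℝ := |F| + |F'| + |G| + |G'| + 1 with hN
  set P : ℝ := N * (G' + F') / (F * G' - F' * G)
  set Q : ℝ := -(N * (F + G)) / (F * G' - F' * G)
  have hPD : P * (F * G' - F' * G) = N * (G' + F') := div_mul_cancel₀ _ hD
  have hQD : Q * (F * G' - F' * G) = -(N * (F + G)) := div_mul_cancel₀ _ hD
  have e1 : P * F + Q * F' = N := by
    apply mul_right_cancel₀ hD
    linear_combination F * hPD + F' * hQD
  have e2 : P * G + Q * G' = -N := by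
    apply mul_right_cancel₀ hD
    linear_combination G * hPD + G' * hQD
  have bound (t a : ℝ) : |(round t - t) * a| ≤ |a| := by
    rw [abs_mul]
    have : |(round t : ℝ) - t| ≤ 1 := by
      rw [abs_sub_comm]
      exact (abs_sub_round t).trans (by norm_num)
    exact mul_le_of_le_one_left (abs_nonneg a) this
  have b1 := abs_le.mp (bound P F)
  have b2 := abs_le.mp (bound Q F')
  have b3 := abs_le.mp (bound P G)
  have b4 := abs_le.mp (bound Q G')
  have n1 := abs_nonneg F
  have n2 := abs_nonneg F'
  have n3 := abs_nonneg G
  have n4 := abs_nonneg G'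
  refine h (round P) (round Q) ?_ ?_
  · nlinarith
  · nlinarith

/-- Change of the unit cost of the player using `S` when a player of weight `w₂` joins
with `T`. -/
def firstChange {m : ℕ} (c : (Fin m → ℝ≥0) → Fin m → ℝ) (x : Fin m → ℝ≥0) (w₁ w₂ : ℝ≥0)
    (S T : Fin m → ℕ) : ℝ :=
  unitCost c S (pairLoad x w₁ w₂ S T) - unitCost c S (pairLoad x w₁ w₂ S 0)

/-- Change of the unit cost of the player using `T` when a player of weight `w₁` joins
with `S`. -/
def secondChange {m : ℕ} (c : (Fin m → ℝ≥0) → Fin m → ℝ) (x : Fin m → ℝ≥0) (w₁ w₂ : ℝ≥0)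
    (S T : Fin m → ℕ) : ℝ :=
  unitCost c T (pairLoad x w₁ w₂ S T) - unitCost c T (pairLoad x w₁ w₂ 0 T)

lemma unitCost_zero {m : ℕ} (c : (Fin m → ℝ≥0) → Fin m → ℝ) (l : Fin m → ℝ≥0) :
    unitCost c 0 l = 0 := by simp [unitCost]

lemma realizes_changes {𝒞 : WCostFamily} (hcomp : WClosedUnderComposition 𝒞) {m : ℕ}
    {c : (Fin m → ℝ≥0) → Fin m → ℝ} (hc : c ∈ 𝒞 m) (x : Fin m → ℝ≥0) (w₁ w₂ : ℝ≥0)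
    {S T : Fin m → ℕ} (hS : ∀ r, S r ≤ 1) (hT : ∀ r, T r ≤ 1) :
    Realizes 𝒞 w₁ w₂ (firstChange c x w₁ w₂ S T) (secondChange c x w₁ w₂ S T) := by
  have h0 (r : Fin m) : (0 : Fin m → ℕ) r ≤ 1 := zero_le_one
  refine ⟨m + m, woplus c c, hcomp m m c hc c hc, Fin.append x x,
    fun i => cond i (Fin.append S 0) (Fin.append 0 S),
    fun i => cond i (Fin.append T 0) (Fin.append 0 T), ?_, ?_, ?_, ?_⟩
  · rintro (_ | _)
    · exact append_le_one h0 hS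
    · exact append_le_one hS h0
  · rintro (_ | _)
    · exact append_le_one h0 hT
    · exact append_le_one hT h0
  · rintro (_ | _) <;>
      simp [unitCost_append, unitCost_zero, firstChange]
  · rintro (_ | _) <;>
      simp [unitCost_append, unitCost_zero, secondChange]

lemma changes_collinear {𝒞 : WCostFamily} (hcomp : WClosedUnderComposition 𝒞)
    (hcons : WConsistent 𝒞) {m m' : ℕ} {c : (Fin m → ℝ≥0) → Fin m → ℝ} (hc : c ∈ 𝒞 m)
    {c' : (Fin m' → ℝ≥0) → Fin m' → ℝ} (hc' : c' ∈ 𝒞 m') (x : Fin m → ℝ≥0) (x' : Fin m' → ℝ≥0)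
    {w₁ w₂ : ℝ≥0} (hw₁ : 0 < w₁) (hw₂ : 0 < w₂) {S T : Fin m → ℕ} {S' T' : Fin m' → ℕ}
    (hS : ∀ r, S r ≤ 1) (hT : ∀ r, T r ≤ 1) (hS' : ∀ r, S' r ≤ 1) (hT' : ∀ r, T' r ≤ 1) :
    firstChange c x w₁ w₂ S T * secondChange c' x' w₁ w₂ S' T'
      = firstChange c' x' w₁ w₂ S' T' * secondChange c x w₁ w₂ S T := by
  refine collinear_of_no_integer_combination fun p q hF hG => ?_
  exact Realizes.not_opposite hcons hw₁ hw₂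
    (((realizes_changes hcomp hc x w₁ w₂ hS hT).intCast_mul hcomp p).add hcomp
      ((realizes_changes hcomp hc' x' w₁ w₂ hS' hT').intCast_mul hcomp q)) hF hG

lemma pairLoad_swap {m : ℕ} (x : Fin m → ℝ≥0) (w₁ w₂ : ℝ≥0) (S T : Fin m → ℕ) :
    pairLoad x w₁ w₂ S T = pairLoad x w₂ w₁ T S := by
  funext r
  simp only [pairLoad]
  ring

lemma firstChange_swap {m : ℕ} (c : (Fin m → ℝ≥0) → Fin m → ℝ) (x : Fin m → ℝ≥0) (w₁ w₂ : ℝ≥0)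
    (S T : Fin m → ℕ) : firstChange c x w₁ w₂ S T = secondChange c x w₂ w₁ T S := by
  simp only [firstChange, secondChange, pairLoad_swap x w₁ w₂]

/-- Two players of equal weight cause the same change of unit cost to each other. -/
lemma changes_symmetric {𝒞 : WCostFamily} (hcomp : WClosedUnderComposition 𝒞)
    (hcons : WConsistent 𝒞) {m : ℕ} {c : (Fin m → ℝ≥0) → Fin m → ℝ} (hc : c ∈ 𝒞 m)
    (x : Fin m → ℝ≥0) {w : ℝ≥0} (hw : 0 < w) {S T : Fin m → ℕ}
    (hS : ∀ r, S r ≤ 1) (hT : ∀ r, T r ≤ 1) :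
    firstChange c x w w S T = secondChange c x w w S T := by
  have h1 := changes_collinear hcomp hcons hc hc x x hw hw hS hT hT hS
  rw [firstChange_swap c x w w T S, ← firstChange_swap c x w w S T] at h1
  have hR := realizes_changes hcomp hc x w w hS hT
  rcases mul_self_eq_mul_self_iff.mp h1 with h | h
  · exact h
  · rcases lt_trichotomy (secondChange c x w w S T) 0 with h2 | h2 | h2
    · exact (hR.not_opposite hcons hw hw (by linarith) h2).elim
    · rw [h, h2, neg_zero]
    · exact (hR.neg.not_opposite hcons hw hw (by linarith) (by linarith)).elim

/-- The load caused by a player of weight `w` using `S`. -/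
def scaledLoad {m : ℕ} (w : ℝ≥0) (S : Fin m → ℕ) : Fin m → ℝ≥0 := fun r => w * S r

lemma pairLoad_eq {m : ℕ} (x : Fin m → ℝ≥0) (w₁ w₂ : ℝ≥0) (S T : Fin m → ℕ) :
    pairLoad x w₁ w₂ S T = x + scaledLoad w₁ S + scaledLoad w₂ T := rfl

lemma scaledLoad_zero {m : ℕ} (w : ℝ≥0) : scaledLoad w (0 : Fin m → ℕ) = 0 := by
  funext r; simp [scaledLoad]

lemma scaledLoad_add {m : ℕ} (w : ℝ≥0) (S T : Fin m → ℕ) :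
    scaledLoad w (S + T) = scaledLoad w S + scaledLoad w T := by
  funext r; simp [scaledLoad, mul_add]

lemma scaledLoad_single {m : ℕ} (w : ℝ≥0) (r : Fin m) :
    scaledLoad w (Pi.single r 1) = Pi.single r w := by
  funext s
  by_cases h : s = r
  · subst h; simp [scaledLoad]
  · simp [scaledLoad, h]

lemma unitCost_single {m : ℕ} (c : (Fin m → ℝ≥0) → Fin m → ℝ) (r : Fin m) (l : Fin m → ℝ≥0) :
    unitCost c (Pi.single r 1) l = c l r := by
  rw [unitCost, Finset.sum_eq_single r]
  · simp
  · intro s _ hs; simp [hs]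
  · simp

lemma unitCost_add {m : ℕ} (c : (Fin m → ℝ≥0) → Fin m → ℝ) (S T : Fin m → ℕ)
    (l : Fin m → ℝ≥0) : unitCost c (S + T) l = unitCost c S l + unitCost c T l := by
  simp [unitCost, add_mul, Finset.sum_add_distrib]

lemma single_le_one {m : ℕ} (r s : Fin m) : (Pi.single r 1 : Fin m → ℕ) s ≤ 1 := by
  by_cases h : s = r
  · subst h; simp
  · simp [h]

lemma single_add_single_le_one {m : ℕ} {r s : Fin m} (hrs : r ≠ s) (t : Fin m) :
    (Pi.single r 1 + Pi.single s 1 : Fin m → ℕ) t ≤ 1 := by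
  by_cases h : t = r
  · subst h; simp [hrs]
  · simpa [h] using single_le_one s t

lemma continuous_single_load {m : ℕ} (r : Fin m) :
    Continuous fun t : ℝ≥0 => (Pi.single r t : Fin m → ℝ≥0) :=
  continuous_single (A := fun _ : Fin m => ℝ≥0) r

/-- A function with linear increments along the coordinates in `I` is linear along `I`. -/
lemma add_sum_single_of_increments {m : ℕ} {g : (Fin m → ℝ≥0) → ℝ} {A : Fin m → ℝ}
    (I : Finset (Fin m))
    (h : ∀ s ∈ I, ∀ x w, g (x + Pi.single s w) = g x + A s * (w : ℝ)) (x y : Fin m → ℝ≥0) :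
    g (x + ∑ s ∈ I, Pi.single s (y s)) = g x + ∑ s ∈ I, A s * (y s : ℝ) := by
  classical
  induction I using Finset.induction_on with
  | empty => simp
  | insert a I ha ih =>
    rw [Finset.sum_insert ha, Finset.sum_insert ha, add_comm (Pi.single a (y a) : Fin m → ℝ≥0),
      ← add_assoc,
      h a (mem_insert_self a I), ih fun s hs => h s (mem_insert_of_mem hs)]
    ring

/-- The mutual changes of unit cost in all games of `𝒞` are proportional to `ℓ`. -/
def ProportionalChanges (𝒞 : WCostFamily) (ℓ : ℝ≥0 → ℝ) : Prop :=
  ∀ m : ℕ, ∀ c ∈ 𝒞 m, ∀ (x : Fin m → ℝ≥0) (w₁ w₂ : ℝ≥0), 0 < w₁ → 0 < w₂ →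
    ∀ S T : Fin m → ℕ, (∀ r, S r ≤ 1) → (∀ r, T r ≤ 1) →
      ℓ w₁ * firstChange c x w₁ w₂ S T = ℓ w₂ * secondChange c x w₁ w₂ S T

section Changes

variable {m : ℕ} (c : (Fin m → ℝ≥0) → Fin m → ℝ) (x : Fin m → ℝ≥0) (w₁ w₂ : ℝ≥0) (r s : Fin m)

lemma firstChange_single : firstChange c x w₁ w₂ (Pi.single r 1) (Pi.single s 1)
    = c (x + Pi.single r w₁ + Pi.single s w₂) r - c (x + Pi.single r w₁) r := by
  simp [firstChange, pairLoad_eq, scaledLoad_zero, scaledLoad_single, unitCost_single]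

lemma secondChange_single : secondChange c x w₁ w₂ (Pi.single r 1) (Pi.single s 1)
    = c (x + Pi.single r w₁ + Pi.single s w₂) s - c (x + Pi.single s w₂) s := by
  simp [secondChange, pairLoad_eq, scaledLoad_zero, scaledLoad_single, unitCost_single]

lemma firstChange_single_add (t : Fin m) :
    firstChange c x w₁ w₂ (Pi.single r 1) (Pi.single s 1 + Pi.single t 1)
      = c (x + Pi.single r w₁ + Pi.single s w₂ + Pi.single t w₂) r
        - c (x + Pi.single r w₁) r := by
  simp [firstChange, pairLoad_eq, scaledLoad_zero, scaledLoad_single, scaledLoad_add,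
    unitCost_single, add_assoc]

lemma secondChange_single_add (t : Fin m) :
    secondChange c x w₁ w₂ (Pi.single r 1) (Pi.single s 1 + Pi.single t 1)
      = (c (x + Pi.single r w₁ + Pi.single s w₂ + Pi.single t w₂) s
          - c (x + Pi.single s w₂ + Pi.single t w₂) s)
        + (c (x + Pi.single r w₁ + Pi.single s w₂ + Pi.single t w₂) t
          - c (x + Pi.single s w₂ + Pi.single t w₂) t) := by
  simp only [secondChange, pairLoad_eq, scaledLoad_zero, scaledLoad_single, scaledLoad_add,
    unitCost_single, unitCost_add, ← add_assoc, add_zero]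
  ring

end Changes

lemma add_single_add_single {m : ℕ} (x : Fin m → ℝ≥0) (r : Fin m) (a b : ℝ≥0) :
    x + Pi.single r a + Pi.single r b = x + Pi.single r (a + b) := by
  rw [add_assoc, ← Pi.single_add]

section Proportional

variable {𝒞 : WCostFamily} {ℓ z : ℝ≥0 → ℝ} {m : ℕ} {c : (Fin m → ℝ≥0) → Fin m → ℝ}

/-- Each cost function is, in its own load, an affine function of `z`. -/
lemma own_load_dependence (hline : ProportionalChanges 𝒞 ℓ) (hz : Continuous z)
    (hinj : Function.Injective z)
    (hρ : ∀ t w₁ w₂, ∃ ρ : ℝ, z (t + w₁ + w₂) - z (t + w₂) = ρ * ℓ w₁ ∧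
      z (t + w₁ + w₂) - z (t + w₁) = ρ * ℓ w₂)
    (hc : c ∈ 𝒞 m) (hcont : Continuous c) (r : Fin m) (x : Fin m → ℝ≥0) :
    ∃ A : ℝ, ∀ t, c (x + Pi.single r t) r = c x r + A * (z t - z 0) := by
  have hh : Continuous fun t => c (x + Pi.single r t) r := by
    have := continuous_single_load r
    fun_prop
  obtain ⟨A, hA⟩ := affine_in_of_increments hh hz hinj (fun w₁ w₂ h1 h2 t => by
    obtain ⟨ρ, e1, e2⟩ := hρ t w₁ w₂
    have := hline m c hc (x + Pi.single r t) w₁ w₂ h1 h2 (Pi.single r 1) (Pi.single r 1)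
      (single_le_one r) (single_le_one r)
    rw [firstChange_single, secondChange_single] at this
    simp only [add_single_add_single] at this
    rw [e1, e2, mul_assoc, mul_assoc, this])
  exact ⟨A, fun t => by simpa using hA t⟩

/-- The increments of a cost function in its own load do not depend on the other loads. -/
lemma own_load_increment_invariant (hline : ProportionalChanges 𝒞 ℓ)
    (hℓ : ∀ w, 0 < w → ℓ w ≠ 0) (hz : Continuous z) (hinj : Function.Injective z)
    (hρ : ∀ t w₁ w₂, ∃ ρ : ℝ, z (t + w₁ + w₂) - z (t + w₂) = ρ * ℓ w₁ ∧
      z (t + w₁ + w₂) - z (t + w₁) = ρ * ℓ w₂)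
    (hc : c ∈ 𝒞 m) (hcont : Continuous c) {r s : Fin m} (hrs : r ≠ s) (x : Fin m → ℝ≥0)
    (w t : ℝ≥0) :
    c (x + Pi.single s w + Pi.single r t) r - c (x + Pi.single s w) r
      = c (x + Pi.single r t) r - c x r := by
  rcases eq_or_ne w 0 with rfl | hw
  · simp
  have hw : 0 < w := pos_iff_ne_zero.mpr hw
  obtain ⟨A, hA⟩ := own_load_dependence hline hz hinj hρ hc hcont r x
  obtain ⟨A', hA'⟩ := own_load_dependence hline hz hinj hρ hc hcont r (x + Pi.single s w)
  have e1 := hline m c hc (x + Pi.single r w) 1 w one_pos hw (Pi.single r 1) (Pi.single s 1)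
    (single_le_one r) (single_le_one s)
  have e2 := hline m c hc x 1 w one_pos hw (Pi.single r 1) (Pi.single r 1 + Pi.single s 1)
    (single_le_one r) (single_add_single_le_one hrs)
  have e3 := hline m c hc x 1 w one_pos hw (Pi.single r 1) (Pi.single r 1)
    (single_le_one r) (single_le_one r)
  rw [firstChange_single, secondChange_single] at e1 e3
  rw [firstChange_single_add, secondChange_single_add] at e2
  have comm1 (y : Fin m → ℝ≥0) (a : ℝ≥0) : y + Pi.single r a + Pi.single s w
      = y + Pi.single s w + Pi.single r a := add_right_comm _ _ _
  simp only [add_single_add_single, comm1, add_comm w 1] at e1 e2 e3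
  have key : c (x + Pi.single s w + Pi.single r (1 + w)) r - c (x + Pi.single s w + Pi.single r w) r
      = c (x + Pi.single r (1 + w)) r - c (x + Pi.single r w) r := by
    apply mul_left_cancel₀ (hℓ w hw)
    linear_combination e1 - e2 + e3
  rw [hA', hA', hA, hA] at key
  have hne : z (1 + w) - z w ≠ 0 := sub_ne_zero.mpr fun e => by
    have := hinj e
    simp at this
  have hAA : A' = A := by
    apply mul_right_cancel₀ hne
    linear_combination key
  rw [hA', hA, hAA]
  ring

/-- The relation between the mutual influences of two resources. -/
lemma cross_increment_relation (hline : ProportionalChanges 𝒞 ℓ)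
    (hℓ : ∀ w, 0 < w → ℓ w ≠ 0) (hz : Continuous z) (hinj : Function.Injective z)
    (hρ : ∀ t w₁ w₂, ∃ ρ : ℝ, z (t + w₁ + w₂) - z (t + w₂) = ρ * ℓ w₁ ∧
      z (t + w₁ + w₂) - z (t + w₁) = ρ * ℓ w₂)
    (hc : c ∈ 𝒞 m) (hcont : Continuous c) {r s : Fin m} (hrs : r ≠ s) (x : Fin m → ℝ≥0)
    {w₁ w₂ : ℝ≥0} (hw₁ : 0 < w₁) (hw₂ : 0 < w₂) :
    ℓ w₁ * (c (x + Pi.single s w₂) r - c x r) = ℓ w₂ * (c (x + Pi.single r w₁) s - c x s) := by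
  have e := hline m c hc x w₁ w₂ hw₁ hw₂ (Pi.single r 1) (Pi.single s 1)
    (single_le_one r) (single_le_one s)
  rw [firstChange_single, secondChange_single] at e
  have h1 := own_load_increment_invariant hline hℓ hz hinj hρ hc hcont hrs x w₂ w₁
  have h2 := own_load_increment_invariant hline hℓ hz hinj hρ hc hcont hrs.symm x w₁ w₂
  rw [add_right_comm] at h1
  linear_combination e - ℓ w₁ * h1 + ℓ w₂ * h2

end Proportional

lemma affine_of_proportionalChanges {𝒞 : WCostFamily}
    (hline : ProportionalChanges 𝒞 fun w => (w : ℝ)) {m : ℕ}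
    {c : (Fin m → ℝ≥0) → Fin m → ℝ} (hc : c ∈ 𝒞 m) (hcont : Continuous c) :
    ∃ A : Matrix (Fin m) (Fin m) ℝ, A.IsSymm ∧ ∃ b : Fin m → ℝ, ∀ x r,
      c x r = (∑ s, A r s * (x s : ℝ)) + b r := by
  have hℓ : ∀ w : ℝ≥0, 0 < w → (w : ℝ) ≠ 0 := fun w hw => (NNReal.coe_pos.mpr hw).ne'
  have hz : Continuous fun w : ℝ≥0 => (w : ℝ) := NNReal.continuous_coe
  have hinj : Function.Injective fun w : ℝ≥0 => (w : ℝ) := NNReal.coe_injective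
  have hρ : ∀ t w₁ w₂ : ℝ≥0, ∃ ρ : ℝ, ((t + w₁ + w₂ : ℝ≥0) : ℝ) - (t + w₂ : ℝ≥0) = ρ * w₁ ∧
      ((t + w₁ + w₂ : ℝ≥0) : ℝ) - (t + w₁ : ℝ≥0) = ρ * w₂ := fun t w₁ w₂ =>
    ⟨1, by push_cast; ring, by push_cast; ring⟩
  have hown := own_load_dependence hline hz hinj hρ hc hcont
  have hinv {r s : Fin m} (hrs : r ≠ s) :=
    own_load_increment_invariant hline hℓ hz hinj hρ hc hcont hrs
  have hcross {r s : Fin m} (hrs : r ≠ s) (x : Fin m → ℝ≥0) {w₁ w₂ : ℝ≥0} :=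
    cross_increment_relation hline hℓ hz hinj hρ hc hcont hrs x (w₁ := w₁) (w₂ := w₂)
  let D (r s : Fin m) (x : Fin m → ℝ≥0) : ℝ := c (x + Pi.single s 1) r - c x r
  have hD (r s : Fin m) (x : Fin m → ℝ≥0) (w : ℝ≥0) :
      c (x + Pi.single s w) r = c x r + D r s x * w := by
    simp only [D]
    by_cases hrs : r = s
    · subst hrs
      obtain ⟨A, hA⟩ := hown r x
      simp [hA]
    · rcases eq_or_ne w 0 with rfl | hw
      · simp
      have hw := pos_iff_ne_zero.mpr hw
      have h1 := hcross hrs x one_pos hw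
      have h2 := hcross hrs x one_pos one_pos
      simp only [NNReal.coe_one] at h1 h2
      linear_combination h1 - w * h2
  have hDsymm {r s : Fin m} (hrs : r ≠ s) (x : Fin m → ℝ≥0) : D r s x = D s r x := by
    have := hcross hrs x one_pos one_pos
    simp only [NNReal.coe_one] at this
    simp only [D]
    linear_combination this
  have hDcol (r s : Fin m) (x : Fin m → ℝ≥0) (w : ℝ≥0) : D r s (x + Pi.single s w) = D r s x := by
    have h1 := hD r s x (w + 1)
    have h2 := hD r s x w
    simp only [D, add_single_add_single] at h1 h2 ⊢
    push_cast at h1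
    linear_combination h1 - h2
  have hDinv (r s t : Fin m) (x : Fin m → ℝ≥0) (w : ℝ≥0) : D r s (x + Pi.single t w) = D r s x := by
    by_cases hts : t = s
    · subst hts; exact hDcol r t x w
    by_cases hrs : r = s
    · subst hrs; exact hinv (Ne.symm hts) x w 1
    by_cases htr : t = r
    · subst htr
      rw [hDsymm hrs, hDcol, hDsymm hrs]
    rcases eq_or_ne w 0 with rfl | hw
    · simp
    have hw := pos_iff_ne_zero.mpr hw
    have e := hline m c hc x 1 w one_pos hw (Pi.single r 1) (Pi.single s 1 + Pi.single t 1)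
      (single_le_one r) (single_add_single_le_one (Ne.symm hts))
    rw [firstChange_single_add, secondChange_single_add] at e
    have a1 : x + Pi.single r 1 + Pi.single s w + Pi.single t w
        = x + Pi.single s w + Pi.single t w + Pi.single r 1 := by abel
    have b1 := hD r t (x + Pi.single r 1 + Pi.single s w) w
    have b2 := hD r s (x + Pi.single r 1) w
    have b3 := hD s r (x + Pi.single s w + Pi.single t w) 1
    have b4 := hD t r (x + Pi.single s w + Pi.single t w) 1
    have d1 : D r t (x + Pi.single r 1 + Pi.single s w) = D r t (x + Pi.single s w) := by
      rw [add_right_comm, hDsymm (Ne.symm htr), hDcol, hDsymm (Ne.symm htr)]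
    have d2 : D r s (x + Pi.single r 1) = D r s x := by
      rw [hDsymm hrs, hDcol, hDsymm hrs]
    have d3 : D s r (x + Pi.single s w + Pi.single t w) = D r s (x + Pi.single t w) := by
      rw [add_right_comm, ← hDsymm hrs, hDcol]
    have d4 : D t r (x + Pi.single s w + Pi.single t w) = D r t (x + Pi.single s w) := by
      rw [← hDsymm (Ne.symm htr), hDcol]
    rw [b1, b2, a1, b3, b4, d1, d2, d3, d4] at e
    simp only [NNReal.coe_one, mul_one, one_mul] at e
    apply mul_right_cancel₀ (hℓ w hw)
    linear_combination -e
  have hDconst (r s : Fin m) (x : Fin m → ℝ≥0) : D r s x = D r s 0 := by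
    have := add_sum_single_of_increments (g := D r s) (A := fun _ => 0) univ
      (fun t _ y w => by simpa using hDinv r s t y w) 0 x
    simpa [Finset.univ_sum_single] using this
  refine ⟨Matrix.of fun r s => D r s 0, Matrix.IsSymm.ext fun r s => ?_, fun r => c 0 r,
    fun x r => ?_⟩
  · by_cases hrs : r = s
    · rw [hrs]
    · exact hDsymm (Ne.symm hrs) 0
  · have := add_sum_single_of_increments (g := fun y => c y r) (A := fun s => D r s 0) univ
      (fun s _ y w => by rw [hD, hDconst]) 0 x
    simp only [Finset.univ_sum_single, zero_add] at this
    rw [this, add_comm]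
    rfl

lemma exp_of_proportionalChanges {𝒞 : WCostFamily} {φ : ℝ} (hφ : φ ≠ 0)
    (hline : ProportionalChanges 𝒞 fun w => 1 - Real.exp (-(φ * w))) {m : ℕ}
    {c : (Fin m → ℝ≥0) → Fin m → ℝ} (hc : c ∈ 𝒞 m) (hcont : Continuous c) :
    ∃ a b : Fin m → ℝ, ∀ x r, c x r = a r * Real.exp (φ * (x r : ℝ)) + b r := by
  have hℓ : ∀ w : ℝ≥0, 0 < w → 1 - Real.exp (-(φ * w)) ≠ 0 := by
    intro w hw h
    have := Real.exp_eq_one_iff _ |>.mp (sub_eq_zero.mp h).symm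
    simp [hφ, hw.ne'] at this
  have hz : Continuous fun w : ℝ≥0 => Real.exp (φ * w) := by fun_prop
  have hinj : Function.Injective fun w : ℝ≥0 => Real.exp (φ * w) := fun a b h =>
    NNReal.coe_injective (mul_left_cancel₀ hφ (Real.exp_injective h))
  have hρ : ∀ t w₁ w₂ : ℝ≥0, ∃ ρ : ℝ,
      Real.exp (φ * (t + w₁ + w₂ : ℝ≥0)) - Real.exp (φ * (t + w₂ : ℝ≥0))
        = ρ * (1 - Real.exp (-(φ * w₁))) ∧
      Real.exp (φ * (t + w₁ + w₂ : ℝ≥0)) - Real.exp (φ * (t + w₁ : ℝ≥0))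
        = ρ * (1 - Real.exp (-(φ * w₂))) := by
    refine fun t w₁ w₂ => ⟨Real.exp (φ * (t + w₁ + w₂ : ℝ≥0)), ?_, ?_⟩ <;>
    · rw [mul_sub, ← Real.exp_add, mul_one]
      push_cast
      ring_nf
  have hown := own_load_dependence hline hz hinj hρ hc hcont
  have hinv {r s : Fin m} (hrs : r ≠ s) :=
    own_load_increment_invariant hline hℓ hz hinj hρ hc hcont hrs
  have hcross {r s : Fin m} (hrs : r ≠ s) (x : Fin m → ℝ≥0) {w₁ w₂ : ℝ≥0} :=
    cross_increment_relation hline hℓ hz hinj hρ hc hcont hrs x (w₁ := w₁) (w₂ := w₂)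
  have hunit {r s : Fin m} (hrs : r ≠ s) (x : Fin m → ℝ≥0) :
      c (x + Pi.single s 1) r - c x r = 0 := by
    have h1 := hcross hrs x one_pos one_pos
    have h2 := hcross hrs (x + Pi.single s 1) one_pos one_pos
    have h3 := hcross hrs x (w₁ := 1) (w₂ := 2) one_pos two_pos
    have hl := hℓ 1 one_pos
    simp only [add_single_add_single, one_add_one_eq_two, NNReal.coe_one, mul_one] at h1 h2 h3 hl
    have hq : Real.exp (-(φ * (2 : ℝ≥0))) = Real.exp (-φ) * Real.exp (-φ) := by
      rw [← Real.exp_add]; push_cast; ring_nf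
    rw [hq] at h3
    set q := Real.exp (-φ)
    have h4' : c (x + Pi.single s 1 + Pi.single r 1) s - c (x + Pi.single s 1) s
        = c (x + Pi.single r 1) s - c x s := by
      have := hinv hrs.symm x 1 1
      rw [add_right_comm] at this
      linear_combination this
    have e1 := mul_left_cancel₀ hl h1
    have e2 := mul_left_cancel₀ hl h2
    apply mul_left_cancel₀ (mul_ne_zero hl hl)
    rw [h4', ← e1] at e2
    rw [← e1] at h3
    linear_combination h3 - (1 - q) * e2
  have hzero {r s : Fin m} (hrs : r ≠ s) (x : Fin m → ℝ≥0) (w : ℝ≥0) :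
      c (x + Pi.single s w) r = c x r := by
    rcases eq_or_ne w 0 with rfl | hw
    · simp
    have h1 := hcross hrs x one_pos (pos_iff_ne_zero.mpr hw)
    rw [hunit hrs.symm, mul_zero] at h1
    exact sub_eq_zero.mp ((mul_eq_zero.mp h1).resolve_left (hℓ 1 one_pos))
  choose A hA using fun r => hown r 0
  refine ⟨A, fun r => c 0 r - A r, fun x r => ?_⟩
  have h1 := add_sum_single_of_increments (g := fun y => c y r) (A := fun _ => 0) (univ.erase r)
    (fun s hs y w => by simpa using hzero (Finset.ne_of_mem_erase hs).symm y w)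
    (Pi.single r (x r)) x
  have h2 := hA r (x r)
  simp only [Finset.add_sum_erase univ (fun s => Pi.single s (x s)) (mem_univ r),
    Finset.univ_sum_single, zero_mul, Finset.sum_const_zero, add_zero] at h1
  simp only [zero_add, NNReal.coe_zero, mul_zero, Real.exp_zero] at h2
  rw [h1, h2]
  ring

/-- Either all cost functions are constant, or the mutual changes of unit cost are proportional
to the weights, or they are proportional to an exponential expression in the weights. -/
lemma constant_or_proportionalChanges {𝒞 : WCostFamily}
    (hcont : ∀ m : ℕ, ∀ c ∈ 𝒞 m, Continuous c)
    (hcomp : WClosedUnderComposition 𝒞) (hcons : WConsistent 𝒞) :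
    (∀ m, ∀ c ∈ 𝒞 m, ∀ x r, c x r = c 0 r) ∨ ProportionalChanges 𝒞 (fun w => (w : ℝ)) ∨
      ∃ φ : ℝ, φ ≠ 0 ∧ ProportionalChanges 𝒞 fun w => 1 - Real.exp (-(φ * w)) := by
  by_cases hdiag : ∀ m, ∀ c ∈ 𝒞 m, ∀ x r t, c (x + Pi.single r t) r = c x r
  · by_cases hoff : ∀ m, ∀ c ∈ 𝒞 m, ∀ x r s t, c (x + Pi.single s t) r = c x r
    · left
      intro m c hc x r
      have := add_sum_single_of_increments (g := fun y => c y r) (A := fun _ => 0) univ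
        (fun s _ y w => by simpa using hoff m c hc y r s w) 0 x
      simpa [Finset.univ_sum_single] using this
    right; left
    push Not at hoff
    obtain ⟨m, c, hc, x, r, s, t₀, hne⟩ := hoff
    have hd := hdiag m c hc
    have hcc := hcont m c hc
    have hsymm (y : Fin m → ℝ≥0) (w : ℝ≥0) :
        c (y + Pi.single s w) r - c y r = c (y + Pi.single r w) s - c y s := by
      rcases eq_or_ne w 0 with rfl | hw
      · simp
      have := changes_symmetric hcomp hcons hc y (pos_iff_ne_zero.mpr hw)
        (single_le_one r) (single_le_one s)
      rw [firstChange_single, secondChange_single, hd _ s, add_right_comm, hd _ r, hd _ r,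
        hd _ s] at this
      exact this
    have hlin := nnreal_additive_linear (H := fun b => c (x + Pi.single s b) r - c x r) (by
        have := continuous_single_load s
        fun_prop) (fun a b => by
        have h1 := hsymm (x + Pi.single s a) b
        have h2 := hsymm x b
        rw [add_right_comm x _ (Pi.single r b), hd _ s, hd _ s, add_single_add_single] at h1
        linear_combination h1 - h2)
    set κ := c (x + Pi.single s 1) r - c x r
    have hκ0 : κ ≠ 0 := fun h0 => hne (by
      have := hlin t₀
      rw [h0, mul_zero] at this
      exact sub_eq_zero.mp this)
    intro m' c' hc' x' w₁ w₂ hw₁ hw₂ S T hS hT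
    have := changes_collinear hcomp hcons hc' hc x' x hw₁ hw₂ hS hT (single_le_one r)
      (single_le_one s)
    have hf : firstChange c x w₁ w₂ (Pi.single r 1) (Pi.single s 1) = w₂ * κ := by
      rw [firstChange_single, add_right_comm, hd _ r, hd _ r, hlin]
    have hg : secondChange c x w₁ w₂ (Pi.single r 1) (Pi.single s 1) = w₁ * κ := by
      rw [secondChange_single, hd _ s, hd _ s, ← hsymm, hlin]
    rw [hf, hg] at this
    apply mul_right_cancel₀ hκ0
    linear_combination this
  · right
    push Not at hdiag
    obtain ⟨m, c, hc, x, r, t₀, hne⟩ := hdiag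
    set k : ℝ≥0 → ℝ := fun t => c (x + Pi.single r t) r with hk
    have hkc : Continuous k := by
      have := continuous_single_load r
      have := hcont m c hc
      fun_prop
    have hf (t w₁ w₂ : ℝ≥0) : firstChange c (x + Pi.single r t) w₁ w₂ (Pi.single r 1)
        (Pi.single r 1) = k (t + w₁ + w₂) - k (t + w₁) := by
      simp only [firstChange_single, add_single_add_single, hk]
    have hg (t w₁ w₂ : ℝ≥0) : secondChange c (x + Pi.single r t) w₁ w₂ (Pi.single r 1)
        (Pi.single r 1) = k (t + w₁ + w₂) - k (t + w₂) := by
      simp only [secondChange_single, add_single_add_single, hk]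
    obtain ⟨α, hα, hform⟩ := affine_or_exp_of_collinear hkc ⟨t₀, by simpa [hk] using hne⟩
      (fun w₁ w₂ hw₁ hw₂ t t' => by
        have := changes_collinear hcomp hcons hc hc (x + Pi.single r t) (x + Pi.single r t')
          hw₁ hw₂ (single_le_one r) (single_le_one r) (single_le_one r) (single_le_one r)
        rwa [hf, hg, hf, hg] at this)
    have hcol {m' : ℕ} {c' : (Fin m' → ℝ≥0) → Fin m' → ℝ} (hc' : c' ∈ 𝒞 m')
        (x' : Fin m' → ℝ≥0) {w₁ w₂ : ℝ≥0} (hw₁ : 0 < w₁) (hw₂ : 0 < w₂) {S T : Fin m' → ℕ}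
        (hS : ∀ r, S r ≤ 1) (hT : ∀ r, T r ≤ 1) :
        firstChange c' x' w₁ w₂ S T * (k (w₁ + w₂) - k w₂)
          = (k (w₁ + w₂) - k w₁) * secondChange c' x' w₁ w₂ S T := by
      have := changes_collinear hcomp hcons hc' hc x' (x + Pi.single r 0) hw₁ hw₂ hS hT
        (single_le_one r) (single_le_one r)
      rw [hf, hg] at this
      simpa only [zero_add] using this
    rcases hform with hform | ⟨φ, hφ, hform⟩
    · left
      intro m' c' hc' x' w₁ w₂ hw₁ hw₂ S T hS hT
      have := hcol hc' x' hw₁ hw₂ hS hT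
      rw [hform (w₁ + w₂), hform w₁, hform w₂] at this
      push_cast at this
      apply mul_left_cancel₀ hα
      linear_combination this
    · right
      refine ⟨φ, hφ, ?_⟩
      intro m' c' hc' x' w₁ w₂ hw₁ hw₂ S T hS hT
      have := hcol hc' x' hw₁ hw₂ hS hT
      rw [hform (w₁ + w₂), hform w₁, hform w₂] at this
      push_cast at this
      have e1 : Real.exp (φ * w₂) = Real.exp (φ * (w₁ + w₂)) * Real.exp (-(φ * w₁)) := by
        rw [← Real.exp_add]; ring_nf
      have e2 : Real.exp (φ * w₁) = Real.exp (φ * (w₁ + w₂)) * Real.exp (-(φ * w₂)) := by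
        rw [← Real.exp_add]; ring_nf
      rw [e1, e2] at this
      apply mul_left_cancel₀ (mul_ne_zero hα (Real.exp_ne_zero (φ * (w₁ + w₂))))
      linear_combination this


/-- Lemma (necessity): a consistent, composition-closed set of continuous cost functions
consists only of affine functions with symmetric linear part, or only of separable
exponential functions with a common exponent. -/
theorem necessary_weighted (𝒞 : WCostFamily)
    (hcont : ∀ m : ℕ, ∀ c ∈ 𝒞 m, Continuous c)
    (hcomp : WClosedUnderComposition 𝒞) (hcons : WConsistent 𝒞) :
    (∀ m : ℕ, ∀ c ∈ 𝒞 m, ∃ A : Matrix (Fin m) (Fin m) ℝ, A.IsSymm ∧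
        ∃ b : Fin m → ℝ, ∀ x : Fin m → NNReal, ∀ r : Fin m,
          c x r = (∑ s, A r s * (x s : ℝ)) + b r) ∨
      (∃ φ : ℝ, ∀ m : ℕ, ∀ c ∈ 𝒞 m, ∃ a b : Fin m → ℝ,
        ∀ x : Fin m → NNReal, ∀ r : Fin m,
          c x r = a r * Real.exp (φ * (x r : ℝ)) + b r) := by
  rcases constant_or_proportionalChanges hcont hcomp hcons with h | h | ⟨φ, hφ, h⟩
  · exact Or.inl fun m c hc => ⟨0, Matrix.isSymm_zero, c 0, fun x r => by simp [h m c hc x r]⟩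
  · exact Or.inl fun m c hc => affine_of_proportionalChanges h hc (hcont m c hc)
  · exact Or.inr ⟨φ, fun m c hc => exp_of_proportionalChanges hφ h hc (hcont m c hc)⟩
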